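/- arXiv:1302.3670 — 5 statements merged into one kernel-verified Lean document; each statement's English description precedes it below -/
import Mathlib

section
/- Let E be a countable directed graph and let M be a maximal tail in E. Then the set (E⁰ ∖ M)_∞^∅ is either empty or consists of exactly one vertex. -/
/-- A countable directed graph with vertex type `V` and edge type `E`,
given by source and range maps. -/
structure DGraph (V : Type) (E : Type) where
  s : E → V
  r : E → V

namespace DGraph

variable {V E : Type}

/-- One-step relation: there is an edge from `v` to `w`. -/
def Step (G : DGraph V E) (v w : V) : Prop := ∃ e, G.s e = v ∧ G.r e = w

/-- `v ≥ w`: `v = w` or there is a path from `v` to `w`. -/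
def Reach (G : DGraph V E) (v w : V) : Prop := Relation.ReflTransGen G.Step v w

/-- A set `H` is hereditary if `v ∈ H` and `v ≥ w` imply `w ∈ H`. -/
def Hereditary (G : DGraph V E) (H : Set V) : Prop :=
  ∀ v w, v ∈ H → G.Reach v w → w ∈ H

/-- A set `H` is saturated if every vertex `v` with `s⁻¹(v)` finite and nonempty
and `r(s⁻¹(v)) ⊆ H` belongs to `H`. -/
def Saturated (G : DGraph V E) (H : Set V) : Prop :=
  ∀ v, (G.s ⁻¹' {v}).Finite → (G.s ⁻¹' {v}).Nonempty →
    (∀ e, G.s e = v → G.r e ∈ H) → v ∈ H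

/-- A maximal tail. -/
def MaximalTail (G : DGraph V E) (M : Set V) : Prop :=
  M.Nonempty ∧
  (∀ v w, G.Reach v w → w ∈ M → v ∈ M) ∧
  (∀ v ∈ M, (G.s ⁻¹' {v}).Finite → (G.s ⁻¹' {v}).Nonempty →
    ∃ e, G.s e = v ∧ G.r e ∈ M) ∧
  (∀ v ∈ M, ∀ w ∈ M, ∃ y ∈ M, G.Reach v y ∧ G.Reach w y)

/-- `Ω(X) = {w ∈ E⁰ ∖ X : w ≱ v for all v ∈ X}`. -/
def Omega (G : DGraph V E) (X : Set V) : Set V :=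
  {w | w ∉ X ∧ ∀ v ∈ X, ¬ G.Reach w v}

/-- `H_∞^∅ = {v ∈ E⁰ ∖ H : s⁻¹(v) infinite and s⁻¹(v) ∩ r⁻¹(E⁰ ∖ H) = ∅}`. -/
def InfEmpty (G : DGraph V E) (H : Set V) : Set V :=
  {v | v ∉ H ∧ (G.s ⁻¹' {v}).Infinite ∧ G.s ⁻¹' {v} ∩ G.r ⁻¹' Hᶜ = ∅}

/-- `H_∞^fin = {v ∈ E⁰ ∖ H : s⁻¹(v) infinite and
s⁻¹(v) ∩ r⁻¹(E⁰ ∖ H)` finite and nonempty}`. -/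
def InfFin (G : DGraph V E) (H : Set V) : Set V :=
  {v | v ∉ H ∧ (G.s ⁻¹' {v}).Infinite ∧
    (G.s ⁻¹' {v} ∩ G.r ⁻¹' Hᶜ).Finite ∧ (G.s ⁻¹' {v} ∩ G.r ⁻¹' Hᶜ).Nonempty}

/-- A sink emits no edges. -/
def Sink (G : DGraph V E) (v : V) : Prop := G.s ⁻¹' {v} = ∅

/-- An infinite emitter emits infinitely many edges. -/
def InfiniteEmitter (G : DGraph V E) (v : V) : Prop := (G.s ⁻¹' {v}).Infinite

/-- A graph is row-finite if it has no infinite emitters. -/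
def RowFinite (G : DGraph V E) : Prop := ∀ v, (G.s ⁻¹' {v}).Finite

/-- `v` is the base of a loop: there is a path of positive length from `v` to `v`. -/
def BaseOfLoop (G : DGraph V E) (v : V) : Prop := Relation.TransGen G.Step v v

/-- A breaking vertex: `s⁻¹(v)` is infinite and `s⁻¹(v) ∖ r⁻¹(Ω(v))` is
finite and nonempty. -/
def BreakingVertex (G : DGraph V E) (v : V) : Prop :=
  (G.s ⁻¹' {v}).Infinite ∧
  (G.s ⁻¹' {v} \ G.r ⁻¹' (G.Omega {v})).Finite ∧
  (G.s ⁻¹' {v} \ G.r ⁻¹' (G.Omega {v})).Nonempty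

/-- A T1 graph: no breaking vertices, and whenever `M ⊊ N` are maximal tails,
`Ω(M)_∞^∅` is nonempty and `s⁻¹(Ω(M)_∞^∅) ∩ r⁻¹(N)` is finite. -/
def T1Graph (G : DGraph V E) : Prop :=
  (∀ v, ¬ G.BreakingVertex v) ∧
  ∀ M N : Set V, G.MaximalTail M → G.MaximalTail N → M ⊂ N →
    (G.InfEmpty (G.Omega M)).Nonempty ∧
    (G.s ⁻¹' (G.InfEmpty (G.Omega M)) ∩ G.r ⁻¹' N).Finite

/-- An isolated maximal tail. -/
def Isolated (G : DGraph V E) (M : Set V) : Prop :=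
  (∃ v ∈ M, ∀ N, G.MaximalTail N → v ∈ N → N = M) ∨
  ((G.InfEmpty (G.Omega M)).Nonempty ∧
    (G.s ⁻¹' (G.InfEmpty (G.Omega M)) ∩
      G.r ⁻¹' (⋃₀ {N | G.MaximalTail N ∧ M ⊆ N})).Finite)

/-- An infinite path, given as a sequence of composable edges. -/
def InfinitePath (G : DGraph V E) (α : ℕ → E) : Prop :=
  ∀ i, G.r (α i) = G.s (α (i + 1))

/-- `ΣH(X)`: the smallest hereditary and saturated set containing `X`. -/
def SigmaH (G : DGraph V E) (X : Set V) : Set V :=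
  ⋂₀ {H | X ⊆ H ∧ G.Hereditary H ∧ G.Saturated H}

end DGraph

/-- For a maximal tail `M`, the set `(E⁰ ∖ M)_∞^∅` is either empty
or consists of exactly one vertex. -/
theorem infEmpty_of_maximal_tail_subsingleton
    {V E : Type} [Countable V] [Countable E] (G : DGraph V E)
    (M : Set V) (hM : G.MaximalTail M) :
    (G.InfEmpty Mᶜ).Subsingleton := by
  obtain ⟨-, hup, -, hdir⟩ := hM
  have key : ∀ v ∈ G.InfEmpty Mᶜ, ∀ y ∈ M, G.Reach v y → v = y := by
    rintro v ⟨-, -, hv⟩ y hy h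
    rcases Relation.ReflTransGen.cases_head h with h | ⟨c, ⟨e, he, hc⟩, hcy⟩
    · exact h
    · exfalso
      have hcM : c ∈ M := hup c y hcy hy
      have : e ∈ G.s ⁻¹' {v} ∩ G.r ⁻¹' Mᶜᶜ := by
        refine ⟨he, ?_⟩
        rw [compl_compl]
        show G.r e ∈ M
        rw [hc]
        exact hcM
      rw [hv] at this
      exact this
  intro v hv w hw
  obtain ⟨y, hy, h1, h2⟩ := hdir v (not_not.mp hv.1) w (not_not.mp hw.1)
  exact (key v hv y hy h1).trans (key w hw y hy h2).symm
end

section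
/- Let E be a countable directed graph and let v ∈ E⁰ be a vertex. Then E⁰ ∖ Ω(v) is a maximal tail if and only if v is a sink, an infinite emitter, or the base of a loop. -/
/-- `E⁰ ∖ Ω(v)` is a maximal tail iff `v` is a sink, an infinite
emitter, or the base of a loop. -/
theorem compl_omega_maximalTail_iff
    {V E : Type} [Countable V] [Countable E] (G : DGraph V E) (v : V) :
    G.MaximalTail (G.Omega {v})ᶜ ↔
      G.Sink v ∨ G.InfiniteEmitter v ∨ G.BaseOfLoop v := by
  have hM : ∀ w, w ∈ (G.Omega {v})ᶜ ↔ G.Reach w v := by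
    intro w
    simp only [DGraph.Omega, Set.mem_compl_iff, Set.mem_setOf_eq, Set.mem_singleton_iff,
      forall_eq, not_and, not_not]
    constructor
    · intro h
      by_cases hw : w = v
      · subst hw
        exact Relation.ReflTransGen.refl
      · exact h hw
    · intro h _
      exact h
  constructor
  · rintro ⟨_, _, h2, _⟩
    by_cases hs : (G.s ⁻¹' {v}).Nonempty
    · by_cases hf : (G.s ⁻¹' {v}).Finite
      · obtain ⟨e, he, hr⟩ := h2 v ((hM v).2 Relation.ReflTransGen.refl) hf hs
        exact Or.inr (Or.inr (Relation.TransGen.head' ⟨e, he, rfl⟩ ((hM _).1 hr)))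
      · exact Or.inr (Or.inl hf)
    · exact Or.inl (Set.not_nonempty_iff_eq_empty.1 hs)
  · intro h
    have hv := (hM v).2 Relation.ReflTransGen.refl
    refine ⟨⟨v, hv⟩, ?_, ?_, ?_⟩
    · intro a b hab hb
      exact (hM a).2 (Relation.ReflTransGen.trans hab ((hM b).1 hb))
    · intro a ha hf hn
      have key : Relation.TransGen G.Step a v := by
        rcases Relation.reflTransGen_iff_eq_or_transGen.1 ((hM a).1 ha) with h' | h'
        · subst h'
          rcases h with h | h | h
          · exact absurd h hn.ne_empty
          · exact absurd hf h
          · exact h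
        · exact h'
      obtain ⟨c, ⟨e, he, hc⟩, hcv⟩ := Relation.TransGen.head'_iff.1 key
      subst hc
      exact ⟨e, he, (hM _).2 hcv⟩
    · intro a ha b hb
      exact ⟨v, hv, (hM a).1 ha, (hM b).1 hb⟩
end

section
/- Let E be a countable directed graph which is a T1 graph, and let v ∈ E⁰ be a sink or the base of a loop. Then E⁰ ∖ Ω(v) is a maximal tail containing v, and every maximal tail N with v ∈ N equals E⁰ ∖ Ω(v); hence v is contained in exactly one maximal tail. -/
/-- In a T1 graph, if `v` is a sink or the base of a loop, then
`E⁰ ∖ Ω(v)` is a maximal tail containing `v`, and it is the unique maximal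
tail containing `v`. -/
theorem unique_maximal_tail_of_sink_or_loop
    {V E : Type} [Countable V] [Countable E] (G : DGraph V E)
    (hT1 : G.T1Graph) (v : V) (hv : G.Sink v ∨ G.BaseOfLoop v) :
    G.MaximalTail (G.Omega {v})ᶜ ∧ v ∈ (G.Omega {v})ᶜ ∧
      ∀ N : Set V, G.MaximalTail N → v ∈ N → N = (G.Omega {v})ᶜ := by
  have hmem : ∀ w, w ∈ (G.Omega {v})ᶜ ↔ G.Reach w v := by
    intro w
    simp only [DGraph.Omega, Set.mem_compl_iff, Set.mem_setOf_eq, Set.mem_singleton_iff,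
      forall_eq, not_and, not_not]
    constructor
    · intro h
      by_cases hw : w = v
      · rw [hw]; exact Relation.ReflTransGen.refl
      · exact h hw
    · exact fun h _ => h
  have hstep : ∀ w, G.Reach w v → (G.s ⁻¹' {w}).Nonempty → ∃ e, G.s e = w ∧ G.Reach (G.r e) v := by
    intro w hw hne
    have key : Relation.TransGen G.Step w v := by
      rcases Relation.reflTransGen_iff_eq_or_transGen.mp hw with h | h
      · subst h
        rcases hv with h | h
        · rw [DGraph.Sink] at h
          rw [h] at hne
          exact absurd hne Set.not_nonempty_empty
        · exact h
      · exact h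
    obtain ⟨c, ⟨e, he, rfl⟩, hc⟩ := Relation.TransGen.head'_iff.mp key
    exact ⟨e, he, hc⟩
  have hvM : v ∈ (G.Omega {v})ᶜ := (hmem v).2 Relation.ReflTransGen.refl
  have hM : G.MaximalTail (G.Omega {v})ᶜ := by
    refine ⟨⟨v, hvM⟩, ?_, ?_, ?_⟩
    · intro a b hab hb
      exact (hmem a).2 (Relation.ReflTransGen.trans hab ((hmem b).1 hb))
    · intro w hw _ hne
      obtain ⟨e, he, hr⟩ := hstep w ((hmem w).1 hw) hne
      exact ⟨e, he, (hmem _).2 hr⟩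
    · intro a ha b hb
      exact ⟨v, hvM, (hmem a).1 ha, (hmem b).1 hb⟩
  refine ⟨hM, hvM, ?_⟩
  intro N hN hvN
  by_contra hne
  have hsub : (G.Omega {v})ᶜ ⊆ N := fun w hw => hN.2.1 w v ((hmem w).1 hw) hvN
  obtain ⟨u, hu, hinf, hemp⟩ :=
    (hT1.2 _ N hM hN (hsub.ssubset_of_ne (Ne.symm hne))).1
  have huv : G.Reach u v := by
    by_contra hc
    apply hu
    refine ⟨fun h => hc ((hmem u).1 h), fun w hw huw => hc ?_⟩
    exact Relation.ReflTransGen.trans huw ((hmem w).1 hw)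
  obtain ⟨e, he, hr⟩ := hstep u huv hinf.nonempty
  have : e ∈ G.s ⁻¹' {u} ∩ G.r ⁻¹' (G.Omega (G.Omega {v})ᶜ)ᶜ :=
    ⟨he, fun h => h.1 ((hmem _).2 hr)⟩
  rw [hemp] at this
  exact this
end

section
/- Let E be a countable directed graph which is a T1 graph, and let M be a maximal tail in E which contains a sink or contains the base of a loop. Then M is isolated. -/
theorem DGraph.tail_eq_of_sink {V E : Type} (G : DGraph V E) (v : V) (hs : G.Sink v)
    (N : Set V) (hN : G.MaximalTail N) (hv : v ∈ N) : N = {w | G.Reach w v} := by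
  obtain ⟨_, h1, _, h3⟩ := hN
  ext w
  constructor
  · intro hw
    obtain ⟨y, _, hvy, hwy⟩ := h3 v hv w hw
    rcases Relation.ReflTransGen.cases_head hvy with h | ⟨c, ⟨e, he, _⟩, _⟩
    · subst h; exact hwy
    · have : e ∈ G.s ⁻¹' {v} := he
      rw [hs] at this
      exact this.elim
  · intro hw
    exact h1 w v hw hv

theorem DGraph.tail_eq_of_loop {V E : Type} (G : DGraph V E) (hT1 : G.T1Graph) (v : V)
    (hl : G.BaseOfLoop v)
    (N : Set V) (hN : G.MaximalTail N) (hv : v ∈ N) : N = {w | G.Reach w v} := by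
  have step : ∀ u, G.Reach u v → ∃ e, G.s e = u ∧ G.Reach (G.r e) v := by
    intro u hu
    have ht : Relation.TransGen G.Step u v := Relation.TransGen.trans_right hu hl
    obtain ⟨c, ⟨e, he, hc⟩, h⟩ := Relation.TransGen.head'_iff.mp ht
    subst hc
    exact ⟨e, he, h⟩
  have hMv : G.MaximalTail {w | G.Reach w v} := by
    refine ⟨⟨v, Relation.ReflTransGen.refl⟩, ?_, ?_, ?_⟩
    · intro a b hab hb
      exact Relation.ReflTransGen.trans hab hb
    · intro a ha _ _
      exact step a ha
    · intro a ha b hb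
      exact ⟨v, Relation.ReflTransGen.refl, ha, hb⟩
  have hsub : {w | G.Reach w v} ⊆ N := fun w hw => hN.2.1 w v hw hv
  by_contra hne
  obtain ⟨⟨u, hu, _, hemp⟩, _⟩ :=
    hT1.2 _ N hMv hN (hsub.ssubset_of_ne (fun h => hne h.symm))
  have huv : G.Reach u v := by
    by_contra hc
    exact hu ⟨hc, fun x hx hux => hc (Relation.ReflTransGen.trans hux hx)⟩
  obtain ⟨e, he, hev⟩ := step u huv
  have : e ∈ G.s ⁻¹' {u} ∩ G.r ⁻¹' (G.Omega {w | G.Reach w v})ᶜ :=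
    ⟨he, fun h => h.1 hev⟩
  rw [hemp] at this
  exact this

/-- In a T1 graph, a maximal tail containing a sink or the base of
a loop is isolated. -/
theorem isolated_of_contains_sink_or_loop
    {V E : Type} [Countable V] [Countable E] (G : DGraph V E)
    (hT1 : G.T1Graph) (M : Set V) (hM : G.MaximalTail M)
    (hv : ∃ v ∈ M, G.Sink v ∨ G.BaseOfLoop v) :
    G.Isolated M := by
  obtain ⟨v, hvM, h⟩ := hv
  left
  refine ⟨v, hvM, fun N hN hvN => ?_⟩
  rcases h with h | h
  · rw [G.tail_eq_of_sink v h N hN hvN, G.tail_eq_of_sink v h M hM hvM]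
  · rw [G.tail_eq_of_loop hT1 v h N hN hvN, G.tail_eq_of_loop hT1 v h M hM hvM]
end

section
/- Let E be a row-finite countable directed graph with no sinks, and let H ⊆ E⁰ be a hereditary and saturated set with H ≠ E⁰. Then there exists a maximal tail N of E with N ⊆ E⁰ ∖ H. -/
/-- In a row-finite graph with no sinks, any proper hereditary
and saturated set `H` admits a maximal tail contained in its complement. -/
theorem exists_maximalTail_in_compl_of_hereditary_saturated
    {V E : Type} [Countable V] [Countable E] (G : DGraph V E)
    (hrf : G.RowFinite) (hns : ∀ v, ¬ G.Sink v)
    (H : Set V) (hher : G.Hereditary H) (hsat : G.Saturated H)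
    (hne : H ≠ Set.univ) :
    ∃ N : Set V, G.MaximalTail N ∧ N ⊆ Hᶜ := by
  have hstep : ∀ v : {v // v ∉ H}, ∃ w : {v // v ∉ H}, G.Step v.1 w.1 := by
    rintro ⟨v, hv⟩
    by_contra hcon
    apply hv
    apply hsat v (hrf v) (Set.nonempty_iff_ne_empty.mpr (hns v))
    intro e he
    by_contra hr
    exact hcon ⟨⟨G.r e, hr⟩, e, he, rfl⟩
  choose f hf using hstep
  obtain ⟨v₀, hv₀⟩ := (Set.ne_univ_iff_exists_notMem H).mp hne
  let x : ℕ → {v // v ∉ H} := fun n => f^[n] ⟨v₀, hv₀⟩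
  have hx : ∀ n, G.Step (x n).1 (x (n + 1)).1 := by
    intro n
    simp only [x, Function.iterate_succ_apply']
    exact hf _
  have hmono : ∀ m k, G.Reach (x m).1 (x (m + k)).1 := by
    intro m k
    induction k with
    | zero => exact Relation.ReflTransGen.refl
    | succ k ih => exact Relation.ReflTransGen.tail ih (hx (m + k))
  refine ⟨{v | ∃ n, G.Reach v (x n).1}, ⟨⟨v₀, 0, Relation.ReflTransGen.refl⟩, ?_, ?_, ?_⟩, ?_⟩
  · rintro v w hvw ⟨n, hn⟩
    exact ⟨n, Relation.ReflTransGen.trans hvw hn⟩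
  · rintro v ⟨n, hn⟩ - -
    rcases Relation.ReflTransGen.cases_head hn with h | ⟨c, ⟨e, he, hec⟩, hc⟩
    · obtain ⟨e, he, hr⟩ := hx n
      refine ⟨e, he.trans h.symm, n + 1, ?_⟩
      rw [hr]
      exact Relation.ReflTransGen.refl
    · refine ⟨e, he, n, ?_⟩
      rw [hec]
      exact hc
  · rintro v ⟨n, hn⟩ w ⟨m, hm⟩
    refine ⟨(x (n + m)).1, ⟨n + m, Relation.ReflTransGen.refl⟩,
      Relation.ReflTransGen.trans hn (hmono n m), Relation.ReflTransGen.trans hm ?_⟩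
    rw [Nat.add_comm]
    exact hmono m n
  · rintro v ⟨n, hn⟩ hv
    exact (x n).2 (hher v _ hv hn)
end
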